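/- (The linearized Hilbert-transform phase reconstruction on the resonant component.) Let N be an even natural number and m a natural number with 1 ≤ m and 4m < N. Let c ∈ ℂ and let v[k] = c·exp(i k ω_m) + conj(c)·exp(-i k ω_m). Then f(v)[k] = ( (3/4)·c - (1/4)·conj(c) )·exp(i k ω_m) - ( (1/4)·c - (3/4)·conj(c) )·exp(-i k ω_m) for all k. -/

import Mathlib

/-- Discrete Fourier coefficients: `X_n = (1/N) ∑_{k=0}^{N-1} x[k] exp(-2πi n k / N)`. -/
noncomputable def dft (N : ℕ) (x : Fin N → ℂ) (n : Fin N) : ℂ :=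
  (1 / (N : ℂ)) * ∑ k : Fin N, x k *
    Complex.exp (-2 * (Real.pi : ℂ) * Complex.I * (n.val : ℂ) * (k.val : ℂ) / (N : ℂ))

/-- Sign sequence of the discrete Hilbert transform: `S_0 = 0`, `S_n = 1` for
`1 ≤ n ≤ N/2`, and `S_n = -1` for `N/2 + 1 ≤ n ≤ N - 1`. -/
noncomputable def dhtSign (N : ℕ) (n : Fin N) : ℂ :=
  if n.val = 0 then 0 else if n.val ≤ N / 2 then 1 else -1

/-- Discrete Hilbert transform: `(H_d x)[k] = ∑_{n=0}^{N-1} (-i S_n) X_n exp(2πi n k / N)`. -/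
noncomputable def dht (N : ℕ) (x : Fin N → ℂ) (k : Fin N) : ℂ :=
  ∑ n : Fin N, (-Complex.I * dhtSign N n) * dft N x n *
    Complex.exp (2 * (Real.pi : ℂ) * Complex.I * (n.val : ℂ) * (k.val : ℂ) / (N : ℂ))

/-- The linearized Hilbert-transform phase-reconstruction operator: for a real sequence
`u`, `f(u)[k] = -Im[exp(-i ω_m k) (u[k] sin(ω_m k) + i H_d(k' ↦ u[k'] sin(ω_m k'))[k])]`,
where `ω_m = 2πm/N`. It is the first-order (in the modulation amplitude) approximation of
the phase-modulation reconstructed by the Hilbert transform method. -/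
noncomputable def linRec (N m : ℕ) (u : Fin N → ℝ) (k : Fin N) : ℝ :=
  -(Complex.exp (-Complex.I * ((2 * Real.pi * m / N : ℝ) : ℂ) * (k.val : ℂ)) *
      (((u k * Real.sin (2 * Real.pi * m / N * k.val) : ℝ) : ℂ) +
        Complex.I *
          dht N (fun k' => ((u k' * Real.sin (2 * Real.pi * m / N * k'.val) : ℝ) : ℂ)) k)).im

open Complex in
lemma dft_expo (N : ℕ) (a n : Fin N) :
    dft N (fun k => exp (2 * (Real.pi : ℂ) * I * (a.val : ℂ) * (k.val : ℂ) / (N : ℂ))) n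
      = if n = a then 1 else 0 := by
  have hN : 0 < N := a.pos
  have hN0 : (N : ℂ) ≠ 0 := by exact_mod_cast hN.ne'
  unfold dft
  have hterm : ∀ k : Fin N, exp (2 * (Real.pi : ℂ) * I * (a.val : ℂ) * (k.val : ℂ) / (N : ℂ)) *
      exp (-2 * (Real.pi : ℂ) * I * (n.val : ℂ) * (k.val : ℂ) / (N : ℂ)) =
      (exp (2 * (Real.pi : ℂ) * I * ((a.val : ℂ) - n.val) / N)) ^ (k.val) := by
    intro k
    rw [← exp_add, ← exp_nat_mul]
    congr 1
    field_simp
    ring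
  simp only [hterm]
  rw [Fin.sum_univ_eq_sum_range
    (fun k => (exp (2 * (Real.pi : ℂ) * I * ((a.val : ℂ) - n.val) / N)) ^ k)]
  split_ifs with h
  · subst h
    simp [hN0]
  · have hne : exp (2 * (Real.pi : ℂ) * I * ((a.val : ℂ) - n.val) / N) ≠ 1 := by
      intro h1
      rw [exp_eq_one_iff] at h1
      obtain ⟨z, hz⟩ := h1
      have hpi : (2 * (Real.pi : ℂ) * I) ≠ 0 := two_pi_I_ne_zero
      have h2 : ((a.val : ℂ) - n.val) = z * N := by
        rw [div_eq_iff hN0] at hz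
        apply mul_left_cancel₀ hpi
        rw [hz]; ring
      have h3 : ((a.val : ℤ) - n.val) = z * N := by exact_mod_cast h2
      have ha := a.isLt
      have hn := n.isLt
      have hz0 : z = 0 := by
        have hNz : (0 : ℤ) < N := by exact_mod_cast hN
        have u1 : z < 1 := by by_contra hh; nlinarith
        have u2 : -1 < z := by by_contra hh; nlinarith
        omega
      subst hz0
      apply h
      apply Fin.ext
      omega
    rw [geom_sum_eq hne, ← exp_nat_mul]
    have : exp ((N : ℂ) * (2 * (Real.pi : ℂ) * I * ((a.val : ℂ) - n.val) / N)) = 1 := by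
      rw [exp_eq_one_iff]
      refine ⟨(a.val : ℤ) - n.val, ?_⟩
      push_cast
      field_simp
    rw [this]; simp

open Complex in
lemma dht_expo (N : ℕ) (a k : Fin N) :
    dht N (fun k => exp (2 * (Real.pi : ℂ) * I * (a.val : ℂ) * (k.val : ℂ) / (N : ℂ))) k
      = -I * dhtSign N a *
        exp (2 * (Real.pi : ℂ) * I * (a.val : ℂ) * (k.val : ℂ) / (N : ℂ)) := by
  unfold dht
  simp only [dft_expo]
  rw [Finset.sum_eq_single a]
  · simp
  · intro b _ hb; simp [hb]
  · simp

lemma dht_add (N : ℕ) (f g : Fin N → ℂ) (k : Fin N) :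
    dht N (fun k => f k + g k) k = dht N f k + dht N g k := by
  simp only [dht, dft, add_mul, Finset.sum_add_distrib, mul_add]

lemma dht_smul (N : ℕ) (A : ℂ) (f : Fin N → ℂ) (k : Fin N) :
    dht N (fun k => A * f k) k = A * dht N f k := by
  simp only [dht, dft, Finset.mul_sum, Finset.sum_mul]
  refine Finset.sum_congr rfl fun _ _ => Finset.sum_congr rfl fun _ _ => ?_
  ring

open Complex in
lemma dht_expo_nat (N a : ℕ) (ha : a < N) (k : Fin N) :
    dht N (fun k => exp (2 * (Real.pi : ℂ) * I * (a : ℂ) * (k.val : ℂ) / (N : ℂ))) k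
      = -I * dhtSign N ⟨a, ha⟩ *
        exp (2 * (Real.pi : ℂ) * I * (a : ℂ) * (k.val : ℂ) / (N : ℂ)) :=
  dht_expo N ⟨a, ha⟩ k

/-- The linearized Hilbert-transform phase reconstruction on the resonant component:
for the real-valued sequence `v[k] = c exp(i k ω_m) + conj c exp(-i k ω_m)`, one has
`f(v)[k] = ((3/4)c - (1/4)conj c) exp(i k ω_m) - ((1/4)c - (3/4)conj c) exp(-i k ω_m)`. -/
theorem linRec_mid_freq (N m : ℕ) (hNeven : Even N) (hm : 1 ≤ m) (h4m : 4 * m < N)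
    (c : ℂ) (v : Fin N → ℝ)
    (hv : ∀ k : Fin N, ((v k : ℝ) : ℂ) =
      c * Complex.exp (Complex.I * (k.val : ℂ) * ((2 * Real.pi * m / N : ℝ) : ℂ)) +
      (starRingEnd ℂ) c *
        Complex.exp (-Complex.I * (k.val : ℂ) * ((2 * Real.pi * m / N : ℝ) : ℂ))) :
    ∀ k : Fin N, ((linRec N m v k : ℝ) : ℂ) =
      ((3 / 4) * c - (1 / 4) * (starRingEnd ℂ) c) *
        Complex.exp (Complex.I * (k.val : ℂ) * ((2 * Real.pi * m / N : ℝ) : ℂ)) -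
      ((1 / 4) * c - (3 / 4) * (starRingEnd ℂ) c) *
        Complex.exp (-Complex.I * (k.val : ℂ) * ((2 * Real.pi * m / N : ℝ) : ℂ)) := by
  intro k
  have hN : 0 < N := by omega
  have hN0 : (N : ℂ) ≠ 0 := by exact_mod_cast hN.ne'
  obtain ⟨r, hr⟩ := hNeven
  have hx : (fun k' : Fin N => ((v k' * Real.sin (2 * Real.pi * m / N * k'.val) : ℝ) : ℂ)) =
      fun k' : Fin N =>
        (c / (2 * Complex.I)) * Complex.exp (2 * (Real.pi : ℂ) * Complex.I *
          (((⟨2 * m, by omega⟩ : Fin N).val : ℕ) : ℂ) * (k'.val : ℂ) / (N : ℂ)) +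
        (((starRingEnd ℂ) c - c) / (2 * Complex.I) * Complex.exp (2 * (Real.pi : ℂ) * Complex.I *
          (((⟨0, hN⟩ : Fin N).val : ℕ) : ℂ) * (k'.val : ℂ) / (N : ℂ)) +
        (-(starRingEnd ℂ) c / (2 * Complex.I)) * Complex.exp (2 * (Real.pi : ℂ) * Complex.I *
          (((⟨N - 2 * m, by omega⟩ : Fin N).val : ℕ) : ℂ) * (k'.val : ℂ) / (N : ℂ))) := by
    funext j
    have e1 : Complex.exp (2 * (Real.pi : ℂ) * Complex.I *
          ((2 * m : ℕ) : ℂ) * (j.val : ℂ) / (N : ℂ)) =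
        Complex.exp (Complex.I * (j.val : ℂ) * ((2 * Real.pi * m / N : ℝ) : ℂ)) ^ 2 := by
      rw [← Complex.exp_nat_mul]; congr 1; push_cast; ring
    have e3 : Complex.exp (2 * (Real.pi : ℂ) * Complex.I *
          ((N - 2 * m : ℕ) : ℂ) * (j.val : ℂ) / (N : ℂ)) =
        Complex.exp (-Complex.I * (j.val : ℂ) * ((2 * Real.pi * m / N : ℝ) : ℂ)) ^ 2 := by
      rw [← Complex.exp_nat_mul, Nat.cast_sub (by omega), Complex.exp_eq_exp_iff_exists_int]
      refine ⟨j.val, ?_⟩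
      push_cast; field_simp; ring
    have e2 : Complex.exp (2 * (Real.pi : ℂ) * Complex.I *
          ((0 : ℕ) : ℂ) * (j.val : ℂ) / (N : ℂ)) = 1 := by simp
    have es : ((Real.sin (2 * Real.pi * m / N * j.val) : ℝ) : ℂ) =
        (Complex.exp (Complex.I * (j.val : ℂ) * ((2 * Real.pi * m / N : ℝ) : ℂ)) -
        Complex.exp (-Complex.I * (j.val : ℂ) * ((2 * Real.pi * m / N : ℝ) : ℂ))) /
          (2 * Complex.I) := by
      rw [Complex.ofReal_sin, Complex.sin]
      have a1 : -((2 * Real.pi * m / N * j.val : ℝ) : ℂ) * Complex.I =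
        -Complex.I * (j.val : ℂ) * ((2 * Real.pi * m / N : ℝ) : ℂ) := by push_cast; ring
      have a2 : ((2 * Real.pi * m / N * j.val : ℝ) : ℂ) * Complex.I =
        Complex.I * (j.val : ℂ) * ((2 * Real.pi * m / N : ℝ) : ℂ) := by push_cast; ring
      rw [a1, a2]
      field_simp
      rw [Complex.I_sq]; ring
    have ei : Complex.exp (Complex.I * (j.val : ℂ) * ((2 * Real.pi * m / N : ℝ) : ℂ)) *
        Complex.exp (-Complex.I * (j.val : ℂ) * ((2 * Real.pi * m / N : ℝ) : ℂ)) = 1 := by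
      rw [← Complex.exp_add]; simp
    simp only [e1, e2, e3]
    rw [Complex.ofReal_mul, hv, es]
    generalize Complex.exp (Complex.I * (j.val : ℂ) * ((2 * Real.pi * m / N : ℝ) : ℂ)) = E at *
    generalize Complex.exp (-Complex.I * (j.val : ℂ) * ((2 * Real.pi * m / N : ℝ) : ℂ)) = F at *
    field_simp
    linear_combination ((starRingEnd ℂ) c - c) * ei
  have hd := congrArg (fun x => dht N x k) hx
  simp only [dht_add, dht_smul] at hd
  rw [dht_expo_nat N (2 * m) (by omega), dht_expo_nat N 0 hN,
    dht_expo_nat N (N - 2 * m) (by omega)] at hd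
  have s1 : dhtSign N ⟨2 * m, by omega⟩ = 1 := by
    unfold dhtSign
    rw [if_neg (by simp; omega), if_pos (by simp; omega)]
  have s2 : dhtSign N ⟨0, hN⟩ = 0 := by simp [dhtSign]
  have s3 : dhtSign N ⟨N - 2 * m, by omega⟩ = -1 := by
    unfold dhtSign
    rw [if_neg (by simp; omega), if_neg (by simp; omega)]
  rw [s1, s2, s3] at hd
  have hxk := congrFun hx k
  simp only at hxk
  unfold linRec
  rw [hd, hxk]
  have e1 : Complex.exp (2 * (Real.pi : ℂ) * Complex.I *
        ((2 * m : ℕ) : ℂ) * (k.val : ℂ) / (N : ℂ)) =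
      Complex.exp (Complex.I * (k.val : ℂ) * ((2 * Real.pi * m / N : ℝ) : ℂ)) ^ 2 := by
    rw [← Complex.exp_nat_mul]; congr 1; push_cast; ring
  have e2 : Complex.exp (2 * (Real.pi : ℂ) * Complex.I *
        ((0 : ℕ) : ℂ) * (k.val : ℂ) / (N : ℂ)) = 1 := by simp
  have e4 : -Complex.I * ((2 * Real.pi * m / N : ℝ) : ℂ) * (k.val : ℂ) =
    -Complex.I * (k.val : ℂ) * ((2 * Real.pi * m / N : ℝ) : ℂ) := by ring
  have ei : Complex.exp (Complex.I * (k.val : ℂ) * ((2 * Real.pi * m / N : ℝ) : ℂ)) *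
      Complex.exp (-Complex.I * (k.val : ℂ) * ((2 * Real.pi * m / N : ℝ) : ℂ)) = 1 := by
    rw [← Complex.exp_add]; simp
  have ec : (starRingEnd ℂ)
      (Complex.exp (Complex.I * (k.val : ℂ) * ((2 * Real.pi * m / N : ℝ) : ℂ))) =
      Complex.exp (-Complex.I * (k.val : ℂ) * ((2 * Real.pi * m / N : ℝ) : ℂ)) := by
    rw [← Complex.exp_conj]
    simp only [map_mul, Complex.conj_I, Complex.conj_ofReal, map_natCast]
  have ec' : (starRingEnd ℂ)
      (Complex.exp (-Complex.I * (k.val : ℂ) * ((2 * Real.pi * m / N : ℝ) : ℂ))) =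
      Complex.exp (Complex.I * (k.val : ℂ) * ((2 * Real.pi * m / N : ℝ) : ℂ)) := by
    rw [← ec, Complex.conj_conj]
  simp only [e1, e2, e4]
  generalize Complex.exp (Complex.I * (k.val : ℂ) * ((2 * Real.pi * m / N : ℝ) : ℂ)) = E at *
  generalize Complex.exp (-Complex.I * (k.val : ℂ) * ((2 * Real.pi * m / N : ℝ) : ℂ)) = F at *
  generalize Complex.exp (2 * (Real.pi : ℂ) * Complex.I *
        ((N - 2 * m : ℕ) : ℂ) * (k.val : ℂ) / (N : ℂ)) = G at *
  have hz : ∀ z : ℂ, z = (2 * c * E + ((starRingEnd ℂ) c - c) * F) / (2 * Complex.I) →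
      ((-z.im : ℝ) : ℂ) = ((3 / 4) * c - (1 / 4) * (starRingEnd ℂ) c) * E -
      ((1 / 4) * c - (3 / 4) * (starRingEnd ℂ) c) * F := by
    intro z hz
    rw [Complex.ofReal_neg, Complex.im_eq_sub_conj, hz]
    simp only [map_div₀, map_mul, map_add, map_sub, Complex.conj_I, Complex.conj_conj, ec, ec',
      map_ofNat]
    field_simp
    rw [Complex.I_sq]
    ring
  apply hz
  field_simp
  rw [Complex.I_sq]
  linear_combination 2 * c * E * ei
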